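/- Let Ω ⊊ ℝ^m be a domain with m ≥ 2. Then for every x ∈ Ω the generalized upper Laplace parameter of the continuous function u(x) = -log(d_{∂Ω}(x)) satisfies Δ̄u(x) ≥ -(m-2)/(d_{∂Ω}(x))²; in particular Δ̄u(x) > -∞ everywhere in Ω. -/

import Mathlib

open MeasureTheory Metric Filter Topology Set
open scoped ENNReal

noncomputable section

/-- The positive part of an extended real number, as an extended nonnegative real. -/
def erealToENNReal (x : EReal) : ℝ≥0∞ := if x = ⊤ then ⊤ else ENNReal.ofReal x.toReal

variable {E : Type*} [NormedAddCommGroup E] [MeasureSpace E]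

/-- The mean value `M_u(x,r)` of an extended-real-valued function `u` over the ball `B(x,r)`,
computed as the difference of the integrals of the positive and negative parts. -/
def erealBallAvg (u : E → EReal) (x : E) (r : ℝ) : EReal :=
  (((∫⁻ y in ball x r, erealToENNReal (u y)) / volume (ball x r) : ℝ≥0∞) : EReal)
    - (((∫⁻ y in ball x r, erealToENNReal (-(u y))) / volume (ball x r) : ℝ≥0∞) : EReal)

/-- The sub-mean value property on a set `s`: at each point of `s` the value of `u` is at most
its average over every sufficiently small ball centered at the point and contained in `s`. -/
def SubmeanOn (u : E → EReal) (s : Set E) : Prop :=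
  ∀ x ∈ s, ∃ R > 0, ∀ r : ℝ, 0 < r → r < R → closedBall x r ⊆ s →
    u x ≤ erealBallAvg u x r

/-- `u : E → [-∞,∞)` is subharmonic on `s` if it is upper semicontinuous on `s`, not
identically `-∞` on `s`, takes values in `[-∞,∞)`, and satisfies the sub-mean value
inequality on `s`. -/
def IsSubharmonicOn (u : E → EReal) (s : Set E) : Prop :=
  UpperSemicontinuousOn u s ∧ (¬ ∀ x ∈ s, u x = ⊥) ∧ (∀ x ∈ s, u x < ⊤) ∧ SubmeanOn u s

/-- The generalized upper Laplace parameter (upper Privalov operator)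
`Δ̄u(x) = 2(m+2) · limsup_{r→0⁺} (M_u(x,r) - u(x))/r²`. -/
def upperLaplace (m : ℕ) (u : E → EReal) (x : E) : EReal :=
  ((2 * ((m : ℝ) + 2) : ℝ) : EReal) *
    Filter.limsup (fun r : ℝ => (((r ^ 2)⁻¹ : ℝ) : EReal) * (erealBallAvg u x r - u x))
      (𝓝[>] (0 : ℝ))

open scoped RealInnerProductSpace

lemma erealToENNReal_coe (a : ℝ) : erealToENNReal (a : EReal) = ENNReal.ofReal a := by
  simp [erealToENNReal]

/-- For an integrable real function, the extended-real ball average is the usual average. -/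
lemma erealBallAvg_coe {F : Type*} [NormedAddCommGroup F] [MeasureSpace F] {f : F → ℝ} {x : F}
    {r : ℝ} (hf : IntegrableOn f (ball x r)) (h0 : volume (ball x r) ≠ 0) :
    erealBallAvg (fun y => (f y : EReal)) x r =
      (((∫ y in ball x r, f y) / volume.real (ball x r) : ℝ) : EReal) := by
  have hne : ∀ g : F → ℝ, IntegrableOn g (ball x r) →
      (∫⁻ y in ball x r, ENNReal.ofReal (g y)) / volume (ball x r) ≠ ⊤ := fun g hg =>
    ENNReal.div_ne_top ((lintegral_ofReal_le_lintegral_enorm g).trans_lt hg.2).ne h0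
  have hcoe : ∀ a : ℝ≥0∞, a ≠ ⊤ → (a : EReal) = ((a.toReal : ℝ) : EReal) := fun a ha => by
    rw [← EReal.toReal_coe_ennreal, EReal.coe_toReal (by simpa using ha) (by simp)]
  have hneg : ∀ y, erealToENNReal (-(f y : EReal)) = ENNReal.ofReal (-f y) := fun y => by
    rw [← EReal.coe_neg, erealToENNReal_coe]
  simp only [erealBallAvg, erealToENNReal_coe, hneg]
  rw [hcoe _ (hne f hf), hcoe _ (hne (fun y => -f y) hf.neg), ← EReal.coe_sub,
    integral_eq_lintegral_pos_part_sub_lintegral_neg_part hf, ENNReal.toReal_div,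
    ENNReal.toReal_div, sub_div, measureReal_def]

section BallMoments

variable {F : Type*} [NormedAddCommGroup F] [InnerProductSpace ℝ F] [FiniteDimensional ℝ F]
  [MeasurableSpace F] [BorelSpace F]

lemma setIntegral_ball_sub (g : F → ℝ) (x : F) (r : ℝ) :
    ∫ y in ball x r, g (y - x) = ∫ h in ball (0 : F) r, g h := by
  have := (measurePreserving_sub_right (volume : Measure F) x).setIntegral_preimage_emb
    (MeasurableEquiv.subRight x).measurableEmbedding g (ball 0 r)
  rw [← this]
  congr 2
  ext y
  simp [dist_eq_norm]

lemma setIntegral_ball_comp_isometry (f : F ≃ₗᵢ[ℝ] F) (g : F → ℝ) (r : ℝ) :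
    ∫ h in ball (0 : F) r, g (f h) = ∫ h in ball (0 : F) r, g h := by
  rw [← f.measurePreserving.setIntegral_preimage_emb
    f.toHomeomorph.measurableEmbedding g (ball 0 r)]
  congr 2
  ext y
  simp

lemma setIntegral_ball_inner (w : F) (r : ℝ) : ∫ h in ball (0 : F) r, ⟪h, w⟫ = 0 := by
  have := setIntegral_ball_comp_isometry (LinearIsometryEquiv.neg ℝ) (fun h : F => ⟪h, w⟫) r
  simp only [LinearIsometryEquiv.coe_neg, inner_neg_left, integral_neg] at this
  linarith

lemma Continuous.integrableOn_ball {g : F → ℝ} (hg : Continuous g) (x : F) (r : ℝ) :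
    IntegrableOn g (ball x r) :=
  (hg.continuousOn.integrableOn_compact (isCompact_closedBall x r)).mono_set ball_subset_closedBall

lemma setIntegral_ball_inner_sq_congr {v w : F} (h : ‖v‖ = ‖w‖) (r : ℝ) :
    ∫ h in ball (0 : F) r, ⟪h, v⟫ ^ 2 = ∫ h in ball (0 : F) r, ⟪h, w⟫ ^ 2 := by
  rw [← setIntegral_ball_comp_isometry (Submodule.reflection (ℝ ∙ (v - w))ᗮ)
    (fun h : F => ⟪h, w⟫ ^ 2) r]
  have : ∀ y, ⟪Submodule.reflection (ℝ ∙ (v - w))ᗮ y, w⟫ = ⟪y, v⟫ := fun y => by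
    rw [← LinearIsometryEquiv.inner_map_map (Submodule.reflection (ℝ ∙ (v - w))ᗮ) y v,
      Submodule.reflection_sub h]
  simp_rw [this]

lemma setIntegral_ball_inner_sq (w : F) (r : ℝ) :
    Module.finrank ℝ F * ∫ h in ball (0 : F) r, ⟪h, w⟫ ^ 2 =
      ‖w‖ ^ 2 * ∫ h in ball (0 : F) r, ‖h‖ ^ 2 := by
  set b := stdOrthonormalBasis ℝ F
  have h1 : ∀ i, ∫ h in ball (0 : F) r, ⟪h, w⟫ ^ 2 =
      ‖w‖ ^ 2 * ∫ h in ball (0 : F) r, ⟪h, b i⟫ ^ 2 := fun i => by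
    rw [setIntegral_ball_inner_sq_congr (v := w) (w := ‖w‖ • b i) (by simp [norm_smul]),
      ← integral_const_mul]
    simp [inner_smul_right, mul_pow]
  calc _ = ∑ i, ∫ h in ball (0 : F) r, ⟪h, w⟫ ^ 2 := by simp
    _ = ∑ i, ‖w‖ ^ 2 * ∫ h in ball (0 : F) r, ⟪h, b i⟫ ^ 2 := Finset.sum_congr rfl fun i _ => h1 i
    _ = _ := by
      rw [← Finset.mul_sum, ← integral_finsetSum]
      · simp_rw [b.sum_sq_inner_left]
      · intro i _
        exact Continuous.integrableOn_ball (by fun_prop) 0 r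

lemma setIntegral_ball_norm_sq [Nontrivial F] {r : ℝ} (hr : 0 < r) :
    ∫ h in ball (0 : F) r, ‖h‖ ^ 2 = volume.real (ball (0 : F) r) *
      ((Module.finrank ℝ F : ℝ) / (Module.finrank ℝ F + 2) * r ^ 2) := by
  have hvol : volume.real (ball (0 : F) r) =
      r ^ Module.finrank ℝ F * volume.real (ball (0 : F) 1) := by
    rw [measureReal_def, Measure.addHaar_ball_of_pos volume 0 hr, ENNReal.toReal_mul,
      ENNReal.toReal_ofReal (by positivity), measureReal_def]
  have h1 : ∫ h in ball (0 : F) r, ‖h‖ ^ 2 =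
      ∫ h : F, (Iio r).indicator (fun t : ℝ => t ^ 2) ‖h‖ := by
    rw [← integral_indicator measurableSet_ball]
    congr 1
    ext h
    simp [indicator]
  have hpos : 0 < Module.finrank ℝ F := Module.finrank_pos
  have h2 : ∫ y in Ioi (0 : ℝ), y ^ (Module.finrank ℝ F - 1) •
      (Iio r).indicator (fun t : ℝ => t ^ 2) y =
      r ^ (Module.finrank ℝ F + 2) / (Module.finrank ℝ F + 2) := by
    have : ∀ y : ℝ, y ^ (Module.finrank ℝ F - 1) • (Iio r).indicator (fun t : ℝ => t ^ 2) y =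
        (Iio r).indicator (fun t : ℝ => t ^ (Module.finrank ℝ F + 1)) y := fun y => by
      by_cases hy : y ∈ Iio r
      · rw [indicator_of_mem hy, indicator_of_mem hy, smul_eq_mul, ← pow_add]
        congr 1
        omega
      · simp [indicator_of_notMem hy]
    simp_rw [this]
    rw [setIntegral_indicator measurableSet_Iio, Ioi_inter_Iio, ← integral_Ioc_eq_integral_Ioo,
      ← intervalIntegral.integral_of_le hr.le, integral_pow]
    push_cast
    ring
  rw [h1, integral_fun_norm_addHaar, h2, hvol, nsmul_eq_mul, smul_eq_mul]
  field_simp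
  ring

end BallMoments

/-- Second-order lower bound for `-log ‖·‖` near a nonzero vector, with cubic error term. -/
lemma neg_log_norm_add_lower_bound {F : Type*} [NormedAddCommGroup F] [InnerProductSpace ℝ F]
    {w h : F} {r : ℝ} (hw : 0 < ‖w‖) (hh : ‖h‖ ≤ r) (hr : r ≤ ‖w‖ / 6) :
    -⟪h, w⟫ / ‖w‖ ^ 2 - ‖h‖ ^ 2 / (2 * ‖w‖ ^ 2) + ⟪h, w⟫ ^ 2 / ‖w‖ ^ 4 - 28 * r ^ 3 / ‖w‖ ^ 3 ≤
      -Real.log ‖h + w‖ + Real.log ‖w‖ := by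
  have hr0 : 0 ≤ r := (norm_nonneg h).trans hh
  have hs : |⟪h, w⟫| ≤ r * ‖w‖ := (abs_real_inner_le_norm h w).trans (by gcongr)
  have hq2 : ‖h‖ ^ 2 ≤ r ^ 2 := by gcongr
  have hexp : ‖h + w‖ ^ 2 = ‖h‖ ^ 2 + 2 * ⟪h, w⟫ + ‖w‖ ^ 2 := norm_add_sq_real h w
  set s := ⟪h, w⟫
  set d := ‖w‖
  set q := ‖h‖ ^ 2
  have hq0 : 0 ≤ q := by positivity
  set t := (2 * s + q) / d ^ 2 with ht
  have hsl := abs_le.1 hs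
  have hrd : r * r ≤ r * (d / 6) := by gcongr
  have htabs : |t| ≤ 3 * r / d := by
    rw [ht, abs_div, abs_of_pos (by positivity : 0 < d ^ 2), div_le_div_iff₀ (by positivity) hw]
    have : |2 * s + q| ≤ 3 * r * d := abs_le.2 ⟨by nlinarith, by nlinarith⟩
    nlinarith
  have htx : 3 * r / d ≤ 1 / 2 := by
    rw [div_le_iff₀ hw]
    linarith
  have ht1 : |t| ≤ 1 / 2 := htabs.trans htx
  have hlog : Real.log (1 + t) ≤ t - t ^ 2 / 2 + 2 * |t| ^ 3 := by
    have h1 := Real.abs_log_sub_add_sum_range_le (x := -t) (by rw [abs_neg]; linarith) 2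
    have h2 : |t| ^ 3 / (1 - |t|) ≤ 2 * |t| ^ 3 := by
      rw [div_le_iff₀ (by linarith)]
      nlinarith [pow_nonneg (abs_nonneg t) 3]
    have h3 := (abs_le.1 h1).2
    simp [Finset.sum_range_succ] at h3
    norm_num at h3
    linarith
  have ht3 : |t| ^ 3 ≤ 27 * r ^ 3 / d ^ 3 := by
    calc |t| ^ 3 ≤ (3 * r / d) ^ 3 := by gcongr
      _ = _ := by ring
  have ht2 : 4 * s ^ 2 / d ^ 4 - 4 * r ^ 3 / d ^ 3 ≤ t ^ 2 := by
    have : t ^ 2 - (4 * s ^ 2 / d ^ 4 - 4 * r ^ 3 / d ^ 3) =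
        (4 * (s * q + r ^ 3 * d) + q ^ 2) / d ^ 4 := by
      rw [ht]
      field_simp
      ring
    have h2 : 0 ≤ s * q + r ^ 3 * d := by
      have : |s| * q ≤ r * d * r ^ 2 := by gcongr
      nlinarith [neg_abs_le s]
    have h3 : 0 ≤ (4 * (s * q + r ^ 3 * d) + q ^ 2) / d ^ 4 := by positivity
    linarith
  have hfac : ‖h + w‖ ^ 2 = d ^ 2 * (1 + t) := by
    rw [hexp, ht]
    field_simp
    ring
  have hlogeq : 2 * Real.log ‖h + w‖ = 2 * Real.log d + Real.log (1 + t) := by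
    have h1 := congrArg Real.log hfac
    rw [Real.log_mul (by positivity) (by linarith [(abs_le.1 ht1).1]), Real.log_pow,
      Real.log_pow] at h1
    exact_mod_cast h1
  have e1 : t = 2 * (s / d ^ 2) + 2 * (q / (2 * d ^ 2)) := by
    rw [ht]
    field_simp
  have e2 : 4 * s ^ 2 / d ^ 4 = 4 * (s ^ 2 / d ^ 4) := by ring
  have e3 : ∀ c : ℝ, c * r ^ 3 / d ^ 3 = c * (r ^ 3 / d ^ 3) := fun c => by ring
  rw [e3] at ht3 ⊢
  rw [e2, e3] at ht2
  rw [neg_div]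
  linarith

/-- Averaged lower bound for `-log` of the distance to a set having `a` as a nearest point. -/
lemma neg_log_infDist_average_lower_bound {F : Type*} [NormedAddCommGroup F]
    [InnerProductSpace ℝ F] [FiniteDimensional ℝ F] [MeasurableSpace F] [BorelSpace F]
    [Nontrivial F] {S : Set F} {x a : F} {r : ℝ} (ha : a ∈ S) (hd : infDist x S = dist x a)
    (hpos : 0 < infDist x S) (hr : 0 < r) (hr6 : r ≤ infDist x S / 6) :
    IntegrableOn (fun y => -Real.log (infDist y S)) (ball x r) ∧
    -((Module.finrank ℝ F : ℝ) - 2) / (2 * (Module.finrank ℝ F + 2) * infDist x S ^ 2) -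
        28 * r / infDist x S ^ 3 ≤
      (r ^ 2)⁻¹ * ((∫ y in ball x r, -Real.log (infDist y S)) / volume.real (ball x r) -
        -Real.log (infDist x S)) := by
  set d := infDist x S
  have hdw : ‖x - a‖ = d := by rw [hd, dist_eq_norm]
  have hposy : ∀ y ∈ closedBall x r, 0 < infDist y S := fun y hy => by
    have := infDist_le_infDist_add_dist (s := S) (x := x) (y := y)
    rw [mem_closedBall, dist_comm] at hy
    linarith
  have hint : IntegrableOn (fun y => -Real.log (infDist y S)) (ball x r) := by
    refine (ContinuousOn.integrableOn_compact (isCompact_closedBall x r) ?_).mono_set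
      ball_subset_closedBall
    exact ((continuous_infDist_pt S).continuousOn.log fun y hy => (hposy y hy).ne').neg
  refine ⟨hint, ?_⟩
  set w := x - a
  set V := volume.real (ball (0 : F) r) with hV
  set m : ℝ := (Module.finrank ℝ F : ℝ)
  have hm : 0 < m := Nat.cast_pos.2 Module.finrank_pos
  have hVpos : 0 < V := ENNReal.toReal_pos (measure_ball_pos _ _ hr).ne' measure_ball_lt_top.ne
  let P : F → ℝ := fun h => -(1 / d ^ 2) * ⟪h, w⟫ - 1 / (2 * d ^ 2) * ‖h‖ ^ 2 +
    1 / d ^ 4 * ⟪h, w⟫ ^ 2 + (-28 * r ^ 3 / d ^ 3 - Real.log d)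
  have hle : ∀ y ∈ ball x r, P (y - x) ≤ -Real.log (infDist y S) := fun y hy => by
    have h1 := neg_log_norm_add_lower_bound (w := w) (h := y - x) (r := r) (by rw [hdw]; exact hpos)
      (by rw [← dist_eq_norm]; exact (mem_ball.1 hy).le) (by rw [hdw]; exact hr6)
    have h2 : ‖y - x + w‖ = dist y a := by simp [w, dist_eq_norm]
    have h3 : Real.log (infDist y S) ≤ Real.log (dist y a) :=
      Real.log_le_log (hposy y (ball_subset_closedBall hy)) (infDist_le_dist_of_mem ha)
    rw [h2, hdw] at h1
    have h4 : P (y - x) = -⟪y - x, w⟫ / d ^ 2 - ‖y - x‖ ^ 2 / (2 * d ^ 2) +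
      ⟪y - x, w⟫ ^ 2 / d ^ 4 - 28 * r ^ 3 / d ^ 3 - Real.log d := by
      simp only [P]
      ring
    linarith
  have hmono : ∫ y in ball x r, P (y - x) ≤ ∫ y in ball x r, -Real.log (infDist y S) :=
    setIntegral_mono_on (Continuous.integrableOn_ball (by fun_prop) x r) hint
      measurableSet_ball hle
  have hsq : ∫ h in ball (0 : F) r, ⟪h, w⟫ ^ 2 = d ^ 2 * (V * (r ^ 2 / (m + 2))) := by
    have h1 := setIntegral_ball_inner_sq w r
    rw [setIntegral_ball_norm_sq hr, hdw] at h1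
    apply mul_left_cancel₀ hm.ne'
    rw [h1]
    ring
  have hPint : ∫ y in ball x r, P (y - x) = V * (-(m - 2) / (2 * (m + 2) * d ^ 2) * r ^ 2 -
      28 * r ^ 3 / d ^ 3 - Real.log d) := by
    have i1 : IntegrableOn (fun h : F => -(1 / d ^ 2) * ⟪h, w⟫) (ball 0 r) :=
      Continuous.integrableOn_ball (by fun_prop) 0 r
    have i2 : IntegrableOn (fun h : F => 1 / (2 * d ^ 2) * ‖h‖ ^ 2) (ball 0 r) :=
      Continuous.integrableOn_ball (by fun_prop) 0 r
    have i3 : IntegrableOn (fun h : F => 1 / d ^ 4 * ⟪h, w⟫ ^ 2) (ball 0 r) :=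
      Continuous.integrableOn_ball (by fun_prop) 0 r
    have i4 : IntegrableOn (fun _ : F => -28 * r ^ 3 / d ^ 3 - Real.log d) (ball 0 r) :=
      Continuous.integrableOn_ball (by fun_prop) 0 r
    have i12 : IntegrableOn (fun h : F => -(1 / d ^ 2) * ⟪h, w⟫ - 1 / (2 * d ^ 2) * ‖h‖ ^ 2)
        (ball 0 r) := i1.sub i2
    have i123 : IntegrableOn (fun h : F => -(1 / d ^ 2) * ⟪h, w⟫ - 1 / (2 * d ^ 2) * ‖h‖ ^ 2 +
        1 / d ^ 4 * ⟪h, w⟫ ^ 2) (ball 0 r) := i12.add i3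
    rw [setIntegral_ball_sub P]
    simp only [P]
    rw [integral_add i123 i4, integral_add i12 i3, integral_sub i1 i2,
      integral_const_mul, integral_const_mul, integral_const_mul, setIntegral_ball_inner, hsq,
      setIntegral_ball_norm_sq hr, setIntegral_const, smul_eq_mul]
    simp only [← hV]
    field_simp
    ring
  rw [hPint] at hmono
  rw [Measure.addHaar_real_ball_center, ← hV]
  have h1 := (le_div_iff₀' hVpos).2 hmono
  rw [inv_mul_eq_div, le_div_iff₀ (by positivity)]
  calc _ = -(m - 2) / (2 * (m + 2) * d ^ 2) * r ^ 2 - 28 * r ^ 3 / d ^ 3 := by ring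
    _ ≤ _ := by linarith

/-- Theorem (statement 12): for a domain `Ω ⊊ ℝᵐ`, `m ≥ 2`, the generalized upper Laplace
parameter of `u = -log(d_{∂Ω})` satisfies `Δ̄u(x) ≥ -(m-2)/d_{∂Ω}(x)²` at every `x ∈ Ω`; in
particular `Δ̄u(x) > -∞` everywhere in `Ω`. -/
theorem upperLaplace_negLogDist_lower_bound (m : ℕ) (hm : 2 ≤ m)
    (Ω : Set (EuclideanSpace ℝ (Fin m)))
    (hopen : IsOpen Ω) (hconn : IsConnected Ω) (hne : Ω ≠ Set.univ) :
    ∀ x ∈ Ω,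
      ((-((m : ℝ) - 2) / (infDist x (frontier Ω)) ^ 2 : ℝ) : EReal) ≤
        upperLaplace m (fun y => ((- Real.log (infDist y (frontier Ω)) : ℝ) : EReal)) x ∧
      ⊥ < upperLaplace m (fun y => ((- Real.log (infDist y (frontier Ω)) : ℝ) : EReal)) x := by
  intro x hx
  suffices h : ((-((m : ℝ) - 2) / (infDist x (frontier Ω)) ^ 2 : ℝ) : EReal) ≤
      upperLaplace m (fun y => ((- Real.log (infDist y (frontier Ω)) : ℝ) : EReal)) x from
    ⟨h, (EReal.bot_lt_coe _).trans_le h⟩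
  have hFne : (frontier Ω).Nonempty := nonempty_frontier_iff.2 ⟨⟨x, hx⟩, hne⟩
  have hxF : x ∉ frontier Ω := fun h => disjoint_left.1 (disjoint_frontier_iff_isOpen.2 hopen) h hx
  have hpos : 0 < infDist x (frontier Ω) :=
    (isClosed_frontier.notMem_iff_infDist_pos hFne).1 hxF
  obtain ⟨a, ha, hd⟩ := isClosed_frontier.exists_infDist_eq_dist hFne x
  have : Nontrivial (EuclideanSpace ℝ (Fin m)) :=
    Module.nontrivial_of_finrank_pos (R := ℝ) (by rw [finrank_euclideanSpace_fin]; omega)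
  set d := infDist x (frontier Ω)
  have hev : ∀ᶠ r in 𝓝[>] (0 : ℝ),
      ((-((m : ℝ) - 2) / (2 * (m + 2) * d ^ 2) - 28 * r / d ^ 3 : ℝ) : EReal) ≤
      (((r ^ 2)⁻¹ : ℝ) : EReal) *
        (erealBallAvg (fun y => ((- Real.log (infDist y (frontier Ω)) : ℝ) : EReal)) x r -
          ((- Real.log d : ℝ) : EReal)) := by
    filter_upwards [Ioo_mem_nhdsGT (show (0 : ℝ) < d / 6 by positivity)] with r hr
    obtain ⟨hint, hle⟩ := neg_log_infDist_average_lower_bound ha hd hpos hr.1 hr.2.le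
    rw [finrank_euclideanSpace_fin] at hle
    rw [erealBallAvg_coe hint (measure_ball_pos _ _ hr.1).ne', ← EReal.coe_sub, ← EReal.coe_mul]
    exact EReal.coe_le_coe_iff.2 hle
  have htend : Tendsto (fun r : ℝ =>
      ((-((m : ℝ) - 2) / (2 * (m + 2) * d ^ 2) - 28 * r / d ^ 3 : ℝ) : EReal)) (𝓝[>] 0)
      (𝓝 ((-((m : ℝ) - 2) / (2 * (m + 2) * d ^ 2) : ℝ) : EReal)) := by
    refine (continuous_coe_real_ereal.tendsto _).comp (tendsto_nhdsWithin_of_tendsto_nhds ?_)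
    have hc : Continuous fun r : ℝ =>
      -((m : ℝ) - 2) / (2 * (m + 2) * d ^ 2) - 28 * r / d ^ 3 := by fun_prop
    simpa using hc.tendsto 0
  have hlim := limsup_le_limsup hev
  rw [htend.limsup_eq] at hlim
  have hc0 : (0 : EReal) ≤ ((2 * ((m : ℝ) + 2) : ℝ) : EReal) :=
    EReal.coe_nonneg.2 (by positivity)
  refine le_trans (le_of_eq ?_) (mul_le_mul_of_nonneg_left hlim hc0)
  rw [← EReal.coe_mul]
  congr 1
  field_simp

end
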